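/- Let B be a standard Brownian motion on [0,1] and for c ∈ ℝ set B^c_t := B_t + (3/2) t(2−t)(c − ∫₀¹ B_r dr). Then for every bounded Borel Φ : C([0,1]) → ℝ and every bounded Borel f : ℝ → ℝ, E[Φ(B) f(∫₀¹ B_r dr)] = ∫_ℝ E[Φ(B^c)] f(c) N(0,1/3)(dc); i.e. the family of laws of B^c, c ∈ ℝ, is a regular conditional distribution of B given its time average ∫₀¹ B. -/

import Mathlib

open MeasureTheory ProbabilityTheory Set

/-- `B` is a standard Brownian motion on `[0,1]`: a centered Gaussian process with
continuous paths and covariance `E[B_s B_t] = min s t`. -/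
def IsBrownianMotion {Ω : Type*} [MeasurableSpace Ω] (P : Measure Ω)
    (B : ℝ → Ω → ℝ) : Prop :=
  (∀ t, Measurable (B t)) ∧
  (∀ ω, ContinuousOn (fun t => B t ω) (Icc 0 1)) ∧
  (∀ (n : ℕ) (t : Fin n → ℝ), (∀ i, t i ∈ Icc (0:ℝ) 1) → ∀ c : Fin n → ℝ,
    ∃ v : NNReal,
      Measure.map (fun ω => ∑ i, c i * B (t i) ω) P = gaussianReal 0 v) ∧
  (∀ s ∈ Icc (0:ℝ) 1, ∀ t ∈ Icc (0:ℝ) 1, ∫ ω, B s ω * B t ω ∂P = min s t)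

/-- Left-endpoint Riemann sums with uniform mesh converge to the integral. -/
lemma tendsto_sum_mul_integral_of_continuousOn {f : ℝ → ℝ} (hf : ContinuousOn f (Icc 0 1)) :
    Filter.Tendsto (fun n : ℕ => ∑ i ∈ Finset.range (n + 1), (1 / ((n : ℝ) + 1)) * f (i / (n + 1)))
      Filter.atTop (nhds (∫ r in (0:ℝ)..1, f r)) := by
  rw [Metric.tendsto_atTop]
  intro ε hε
  obtain ⟨δ, hδ, H⟩ := Metric.uniformContinuousOn_iff.1
    (isCompact_Icc.uniformContinuousOn_of_continuous hf) (ε / 2) (by positivity)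
  obtain ⟨N, hN⟩ := exists_nat_one_div_lt hδ
  refine ⟨N, fun n hn => ?_⟩
  have hn0 : (0:ℝ) < n + 1 := by positivity
  have hmesh : 1 / ((n : ℝ) + 1) < δ :=
    (one_div_le_one_div_of_le (by positivity) (by exact_mod_cast Nat.succ_le_succ hn)).trans_lt hN
  have hle : ∀ i : ℕ, (i : ℝ) / (n + 1) ≤ ((i + 1 : ℕ) : ℝ) / (n + 1) := fun i => by
    gcongr; simp
  have hsub : ∀ i < n + 1, Icc ((i : ℝ) / (n + 1)) (((i + 1 : ℕ) : ℝ) / (n + 1)) ⊆ Icc 0 1 := by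
    intro i hi
    refine Icc_subset_Icc (by positivity) ?_
    rw [div_le_one hn0]
    exact_mod_cast hi
  have hint : ∀ i < n + 1, IntervalIntegrable f volume ((i : ℝ) / (n + 1))
      (((i + 1 : ℕ) : ℝ) / (n + 1)) := fun i hi =>
    ContinuousOn.intervalIntegrable (by rw [uIcc_of_le (hle i)]; exact hf.mono (hsub i hi))
  have hsum := intervalIntegral.sum_integral_adjacent_intervals (f := f) (μ := volume)
    (a := fun i : ℕ => (i : ℝ) / (n + 1)) (n := n + 1) hint
  have hend : (((n + 1 : ℕ) : ℝ) / (n + 1)) = 1 := by push_cast; exact div_self hn0.ne'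
  simp only [hend, Nat.cast_zero, zero_div] at hsum
  rw [← hsum, Real.dist_eq, ← Finset.sum_sub_distrib]
  have hterm : ∀ i ∈ Finset.range (n + 1), |(1 / ((n : ℝ) + 1)) * f (i / (n + 1)) -
      ∫ x in ((i : ℝ) / (n + 1))..(((i + 1 : ℕ) : ℝ) / (n + 1)), f x| ≤
      ε / 2 * (1 / ((n : ℝ) + 1)) := by
    intro i hi
    rw [Finset.mem_range] at hi
    have hlen : ((i + 1 : ℕ) : ℝ) / (n + 1) - (i : ℝ) / (n + 1) = 1 / ((n : ℝ) + 1) := by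
      push_cast; ring
    have hconst : (1 / ((n : ℝ) + 1)) * f (i / (n + 1)) =
        ∫ x in ((i : ℝ) / (n + 1))..(((i + 1 : ℕ) : ℝ) / (n + 1)), f (i / (n + 1)) := by
      rw [intervalIntegral.integral_const, hlen, smul_eq_mul]
    rw [hconst, ← intervalIntegral.integral_sub (by simp) (hint i hi)]
    have := intervalIntegral.norm_integral_le_of_norm_le_const (C := ε / 2)
      (f := fun x => f (i / (n + 1)) - f x) (a := (i : ℝ) / (n + 1))
      (b := ((i + 1 : ℕ) : ℝ) / (n + 1)) (by
        intro x hx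
        rw [uIoc_of_le (hle i)] at hx
        refine (H _ (hsub i hi ⟨le_rfl, hle i⟩) _ (hsub i hi (Ioc_subset_Icc_self hx)) ?_).le
        rw [Real.dist_eq, abs_sub_comm, abs_of_nonneg (by linarith [hx.1])]
        linarith [hx.2])
    rwa [hlen, abs_of_pos (by positivity)] at this
  calc |∑ i ∈ Finset.range (n + 1), ((1 / ((n : ℝ) + 1)) * f (i / (n + 1)) -
      ∫ x in ((i : ℝ) / (n + 1))..(((i + 1 : ℕ) : ℝ) / (n + 1)), f x)|
      ≤ ∑ i ∈ Finset.range (n + 1), ε / 2 * (1 / ((n : ℝ) + 1)) :=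
        (Finset.abs_sum_le_sum_abs _ _).trans (Finset.sum_le_sum hterm)
    _ = ε / 2 := by
        rw [Finset.sum_const, Finset.card_range, nsmul_eq_mul]
        push_cast
        field_simp
    _ < ε := by linarith

/-- A pointwise limit of centered Gaussian random variables is a centered Gaussian. -/
lemma exists_map_eq_gaussianReal_of_tendsto {Ω : Type*} [MeasurableSpace Ω] {P : Measure Ω}
    [IsProbabilityMeasure P] {X : ℕ → Ω → ℝ} {Y : Ω → ℝ} (hX : ∀ n, Measurable (X n))
    (hXY : ∀ ω, Filter.Tendsto (fun n => X n ω) Filter.atTop (nhds (Y ω)))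
    (hG : ∀ n, ∃ v : NNReal, P.map (X n) = gaussianReal 0 v) :
    ∃ v : NNReal, P.map Y = gaussianReal 0 v := by
  choose v hv using hG
  have hY : Measurable Y := measurable_of_tendsto_metrizable hX (tendsto_pi_nhds.2 hXY)
  have : IsProbabilityMeasure (P.map Y) := Measure.isProbabilityMeasure_map hY.aemeasurable
  have hchar : ∀ (Z : Ω → ℝ), Measurable Z → ∀ t : ℝ,
      charFun (P.map Z) t = ∫ ω, Complex.exp (t * Z ω * Complex.I) ∂P := fun Z hZ t => by
    rw [charFun_apply_real, integral_map hZ.aemeasurable (by fun_prop)]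
  have hlim : ∀ t : ℝ, Filter.Tendsto (fun n => Complex.exp (-(v n * t ^ 2 / 2 : ℝ)))
      Filter.atTop (nhds (charFun (P.map Y) t)) := by
    intro t
    have h1 : ∀ n, Complex.exp (-(v n * t ^ 2 / 2 : ℝ)) =
        ∫ ω, Complex.exp (t * X n ω * Complex.I) ∂P := fun n => by
      rw [← hchar _ (hX n), hv, charFun_gaussianReal]
      congr 1
      push_cast
      ring
    simp_rw [h1, hchar _ hY]
    refine tendsto_integral_of_dominated_convergence (fun _ => 1) (fun n => ?_)
      (integrable_const _) (fun n => Filter.Eventually.of_forall fun ω => ?_)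
      (Filter.Eventually.of_forall fun ω => ?_)
    · have := hX n
      fun_prop
    · rw [← Complex.ofReal_mul, Complex.norm_exp_ofReal_mul_I]
    · have hc : Continuous fun x : ℝ => Complex.exp (t * x * Complex.I) := by fun_prop
      exact (hc.tendsto _).comp (hXY ω)
  obtain ⟨t, ht, ht0⟩ : ∃ t : ℝ, charFun (P.map Y) t ≠ 0 ∧ t ≠ 0 := by
    have h0 : ∀ᶠ t in nhds (0:ℝ), charFun (P.map Y) t ≠ 0 :=
      (continuous_charFun (μ := P.map Y)).continuousAt.eventually_ne (by simp)
    have h1 : ∀ᶠ t in nhdsWithin (0:ℝ) {0}ᶜ, charFun (P.map Y) t ≠ 0 := h0.filter_mono inf_le_left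
    exact (h1.and self_mem_nhdsWithin).exists
  have hvlim : Filter.Tendsto (fun n => (v n : ℝ)) Filter.atTop
      (nhds (-Real.log ‖charFun (P.map Y) t‖ * 2 / t ^ 2)) := by
    have h2 := (((hlim t).norm.log (by simpa using ht)).neg.mul_const 2).div_const (t ^ 2)
    refine h2.congr fun n => ?_
    rw [← Complex.ofReal_neg, Complex.norm_exp_ofReal, Real.log_exp]
    field_simp
  set w := -Real.log ‖charFun (P.map Y) t‖ * 2 / t ^ 2
  have hw : 0 ≤ w := ge_of_tendsto' hvlim fun n => (v n).2
  obtain ⟨u, hu⟩ : ∃ u : NNReal, (u : ℝ) = w := ⟨⟨w, hw⟩, rfl⟩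
  refine ⟨u, Measure.ext_of_charFun (funext fun s => ?_)⟩
  refine tendsto_nhds_unique (hlim s) ?_
  have hc : Continuous fun x : ℝ => Complex.exp (-(x * s ^ 2 / 2 : ℝ)) := by fun_prop
  have h3 := (hc.tendsto w).comp hvlim
  have hval : Complex.exp (-(u * s ^ 2 / 2 : ℝ)) = charFun (gaussianReal 0 u) s := by
    rw [charFun_gaussianReal]
    congr 1
    push_cast
    ring
  rw [← hu, hval] at h3
  exact h3

/-- A process all of whose finite linear combinations are centered Gaussian is Gaussian. -/
lemma isGaussianProcess_of_linearCombination {Ω T : Type*} [MeasurableSpace Ω] {P : Measure Ω}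
    {X : T → Ω → ℝ} (hX : ∀ t, Measurable (X t))
    (h : ∀ (I : Finset T) (c : I → ℝ), ∃ v : NNReal,
      P.map (fun ω => ∑ i, c i * X i ω) = gaussianReal 0 v) :
    IsGaussianProcess X P := by
  classical
  refine ⟨fun I => ⟨isGaussian_of_map_eq_gaussianReal fun L => ?_⟩⟩
  have hR : Measurable fun ω => I.restrict (X · ω) := measurable_pi_lambda _ fun i => hX i
  have hL : L ∘ (fun ω => I.restrict (X · ω)) =
      fun ω => ∑ i : I, L (Pi.single i 1) * X i ω := by
    funext ω
    refine (L.toLinearMap.pi_apply_eq_sum_univ _).trans (Finset.sum_congr rfl fun i _ => ?_)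
    rw [smul_eq_mul, mul_comm]
    have hsingle : (fun j => if i = j then (1:ℝ) else 0) = Pi.single i 1 := by
      funext j
      simp [Pi.single_apply, eq_comm]
    rw [hsingle]
    rfl
  obtain ⟨v, hv⟩ := h I fun i => L (Pi.single i 1)
  exact ⟨0, v, by rw [Measure.map_map L.continuous.measurable hR, hL, hv]⟩

section Brownian

variable {Ω : Type*} [MeasurableSpace Ω] {P : Measure Ω} {B : ℝ → Ω → ℝ}

lemma IsBrownianMotion.exists_map_eq_gaussianReal_of_mem_span (hB : IsBrownianMotion P B)
    {X : Ω → ℝ} (hX : X ∈ Submodule.span ℝ (range fun t : Icc (0:ℝ) 1 => B t)) :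
    ∃ v : NNReal, P.map X = gaussianReal 0 v := by
  obtain ⟨c, rfl⟩ := Finsupp.mem_span_range_iff_exists_finsupp.1 hX
  let e := c.support.equivFin
  obtain ⟨v, hv⟩ := hB.2.2.1 _ (fun i => ((e.symm i : Icc (0:ℝ) 1) : ℝ))
    (fun i => (e.symm i : Icc (0:ℝ) 1).2) (fun i => c (e.symm i))
  refine ⟨v, hv ▸ congrArg (P.map ·) (funext fun ω => ?_)⟩
  rw [Finsupp.sum, Finset.sum_apply,
    e.symm.sum_comp fun i : c.support => c i * B (i : Icc (0:ℝ) 1) ω,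
    Finset.sum_coe_sort c.support fun i => c i * B i ω]
  rfl

lemma IsBrownianMotion.measurable_of_mem_span (hB : IsBrownianMotion P B)
    {X : Ω → ℝ} (hX : X ∈ Submodule.span ℝ (range fun t : Icc (0:ℝ) 1 => B t)) :
    Measurable X := by
  induction hX using Submodule.span_induction with
  | mem x h => obtain ⟨t, rfl⟩ := h; exact hB.1 t
  | zero => exact measurable_zero
  | add x y _ _ hx hy => exact hx.add hy
  | smul a x _ hx => exact hx.const_smul a

lemma IsBrownianMotion.memLp_two (hB : IsBrownianMotion P B) {t : ℝ} (ht : t ∈ Icc (0:ℝ) 1) :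
    MemLp (B t) 2 P := by
  obtain ⟨v, hv⟩ := hB.exists_map_eq_gaussianReal_of_mem_span
    (Submodule.subset_span ⟨⟨t, ht⟩, rfl⟩)
  have h : HasGaussianLaw (B t) P := ⟨by rw [hv]; infer_instance⟩
  exact h.memLp_two

/-- The time average is a pointwise limit of elements of the linear span of the process. -/
lemma IsBrownianMotion.exists_tendsto_intervalIntegral (hB : IsBrownianMotion P B) :
    ∃ A : ℕ → Ω → ℝ, (∀ n, A n ∈ Submodule.span ℝ (range fun t : Icc (0:ℝ) 1 => B t)) ∧
      ∀ ω, Filter.Tendsto (fun n => A n ω) Filter.atTop (nhds (∫ r in (0:ℝ)..1, B r ω)) := by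
  refine ⟨fun n => ∑ i ∈ Finset.range (n + 1), (1 / ((n : ℝ) + 1)) • B (i / (n + 1)),
    fun n => Submodule.sum_mem _ fun i hi => Submodule.smul_mem _ _ (Submodule.subset_span
      ⟨⟨i / (n + 1), by positivity, ?_⟩, rfl⟩), fun ω => ?_⟩
  · rw [div_le_one (by positivity)]
    exact_mod_cast (Finset.mem_range.1 hi).le
  · simpa using tendsto_sum_mul_integral_of_continuousOn (hB.2.1 ω)

lemma IsBrownianMotion.measurable_intervalIntegral (hB : IsBrownianMotion P B) :
    Measurable fun ω => ∫ r in (0:ℝ)..1, B r ω := by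
  obtain ⟨A, hA, hlim⟩ := hB.exists_tendsto_intervalIntegral
  exact measurable_of_tendsto_metrizable (fun n => hB.measurable_of_mem_span (hA n))
    (tendsto_pi_nhds.2 hlim)

/-- Brownian motion together with its time average, the latter indexed by `none`. -/
noncomputable def withAverage (B : ℝ → Ω → ℝ) : Option (Icc (0:ℝ) 1) → Ω → ℝ
  | none => fun ω => ∫ r in (0:ℝ)..1, B r ω
  | some t => B t

lemma IsBrownianMotion.measurable_withAverage (hB : IsBrownianMotion P B)
    (t : Option (Icc (0:ℝ) 1)) : Measurable (withAverage B t) :=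
  match t with
  | none => hB.measurable_intervalIntegral
  | some t => hB.1 t

lemma IsBrownianMotion.exists_map_withAverage_eq_gaussianReal [IsProbabilityMeasure P]
    (hB : IsBrownianMotion P B) (I : Finset (Option (Icc (0:ℝ) 1))) (c : I → ℝ) :
    ∃ v : NNReal, P.map (fun ω => ∑ i, c i * withAverage B i ω) = gaussianReal 0 v := by
  obtain ⟨A, hA, hlim⟩ := hB.exists_tendsto_intervalIntegral
  let W : ℕ → Option (Icc (0:ℝ) 1) → Ω → ℝ := fun n i => i.elim (A n) fun t => B t
  have hW : ∀ n i, W n i ∈ Submodule.span ℝ (range fun t : Icc (0:ℝ) 1 => B t) := by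
    rintro n (_ | t)
    · exact hA n
    · exact Submodule.subset_span ⟨t, rfl⟩
  have hmem : ∀ n, ∑ i : I, c i • W n i ∈ Submodule.span ℝ (range fun t : Icc (0:ℝ) 1 => B t) :=
    fun n => Submodule.sum_mem _ fun i _ => Submodule.smul_mem _ _ (hW n i)
  refine exists_map_eq_gaussianReal_of_tendsto (fun n => hB.measurable_of_mem_span (hmem n))
    (fun ω => ?_) (fun n => hB.exists_map_eq_gaussianReal_of_mem_span (hmem n))
  simp only [Finset.sum_apply, Pi.smul_apply, smul_eq_mul]
  refine tendsto_finsetSum _ fun i _ => Filter.Tendsto.const_mul _ ?_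
  rcases i with ⟨_ | t, hi⟩
  · exact hlim ω
  · exact tendsto_const_nhds

lemma IsBrownianMotion.isGaussianProcess_withAverage [IsProbabilityMeasure P]
    (hB : IsBrownianMotion P B) : IsGaussianProcess (withAverage B) P :=
  isGaussianProcess_of_linearCombination hB.measurable_withAverage
    hB.exists_map_withAverage_eq_gaussianReal

lemma IsBrownianMotion.integral_withAverage [IsProbabilityMeasure P]
    (hB : IsBrownianMotion P B) (t : Option (Icc (0:ℝ) 1)) : ∫ ω, withAverage B t ω ∂P = 0 := by
  obtain ⟨v, hv⟩ := hB.exists_map_withAverage_eq_gaussianReal {t} fun _ => 1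
  have hsum : (fun ω => ∑ i : ({t} : Finset _), 1 * withAverage B i ω) = withAverage B t := by
    funext ω
    simp
  rw [hsum] at hv
  have := integral_map (μ := P) (φ := withAverage B t) (f := fun x : ℝ => x)
    (hB.measurable_withAverage t).aemeasurable (by fun_prop)
  rw [← this, hv, integral_id_gaussianReal]

/-- Expectation against a square integrable variable commutes with time averaging. -/
lemma IsBrownianMotion.integral_mul_intervalIntegral [IsProbabilityMeasure P]
    (hB : IsBrownianMotion P B) {Z : Ω → ℝ} (hZ : MemLp Z 2 P) :
    ∫ ω, Z ω * (∫ r in (0:ℝ)..1, B r ω) ∂P = ∫ r in (0:ℝ)..1, ∫ ω, Z ω * B r ω ∂P := by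
  let p : ℝ → Icc (0:ℝ) 1 := projIcc 0 1 zero_le_one
  have hp : ∀ r ∈ Ioc (0:ℝ) 1, (p r : ℝ) = r := fun r hr => by
    rw [show p r = _ from projIcc_of_mem zero_le_one (Ioc_subset_Icc_self hr)]
  have hmeas : Measurable (Function.uncurry fun r ω => B (p r) ω) := by
    refine measurable_uncurry_of_continuous_of_measurable (fun ω => ?_) fun r => hB.1 _
    exact (continuousOn_iff_continuous_domRestrict.1 (hB.2.1 ω)).comp continuous_projIcc
  have hF : AEStronglyMeasurable (Function.uncurry fun r ω => Z ω * B (p r) ω)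
      ((volume.restrict (Ioc (0:ℝ) 1)).prod P) :=
    hZ.1.comp_snd.mul hmeas.aestronglyMeasurable
  have hint : Integrable (Function.uncurry fun r ω => Z ω * B (p r) ω)
      ((volume.restrict (Ioc (0:ℝ) 1)).prod P) := by
    have hmul : ∀ r, Integrable (fun ω => Z ω * B (p r) ω) P := fun r =>
      hZ.integrable_mul (hB.memLp_two (p r).2)
    refine (integrable_prod_iff hF).2 ⟨Filter.Eventually.of_forall hmul, ?_⟩
    refine Integrable.mono' (integrable_const (∫ ω, Z ω ^ 2 ∂P + 1))
      hF.norm.integral_prod_right' (Filter.Eventually.of_forall fun r => ?_)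
    have hsq : Integrable (fun ω => B (p r) ω * B (p r) ω) P :=
      (hB.memLp_two (p r).2).integrable_mul (hB.memLp_two (p r).2)
    rw [Real.norm_of_nonneg (integral_nonneg fun ω => norm_nonneg _)]
    calc ∫ ω, ‖Z ω * B (p r) ω‖ ∂P ≤ ∫ ω, (Z ω ^ 2 + B (p r) ω * B (p r) ω) ∂P := by
          refine integral_mono (hmul r).norm (hZ.integrable_sq.add hsq) fun ω => ?_
          simp only [Real.norm_eq_abs]
          rw [abs_le]
          constructor <;> nlinarith [sq_nonneg (Z ω + B (p r) ω), sq_nonneg (Z ω - B (p r) ω),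
            sq_nonneg (Z ω), sq_nonneg (B (p r) ω)]
      _ = ∫ ω, Z ω ^ 2 ∂P + (p r : ℝ) := by
          rw [integral_add hZ.integrable_sq hsq, hB.2.2.2 _ (p r).2 _ (p r).2, min_self]
      _ ≤ ∫ ω, Z ω ^ 2 ∂P + 1 := by linarith [(p r).2.2]
  have hswap := integral_integral_swap hint
  simp only [intervalIntegral.integral_of_le zero_le_one, ← integral_const_mul]
  calc ∫ ω, ∫ r in Ioc (0:ℝ) 1, Z ω * B r ω ∂volume ∂P
      = ∫ ω, ∫ r in Ioc (0:ℝ) 1, Z ω * B (p r) ω ∂volume ∂P :=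
        integral_congr_ae (Filter.Eventually.of_forall fun ω =>
          setIntegral_congr_fun measurableSet_Ioc fun r hr => by simp only [hp r hr])
    _ = ∫ r in Ioc (0:ℝ) 1, ∫ ω, Z ω * B (p r) ω ∂P := hswap.symm
    _ = ∫ r in Ioc (0:ℝ) 1, ∫ ω, Z ω * B r ω ∂P :=
        setIntegral_congr_fun measurableSet_Ioc fun r hr => by simp only [hp r hr]

lemma IsBrownianMotion.integral_mul_average [IsProbabilityMeasure P]
    (hB : IsBrownianMotion P B) {t : ℝ} (ht : t ∈ Icc (0:ℝ) 1) :
    ∫ ω, B t ω * (∫ r in (0:ℝ)..1, B r ω) ∂P = t - t ^ 2 / 2 := by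
  rw [hB.integral_mul_intervalIntegral (hB.memLp_two ht)]
  have hcov : EqOn (fun r => ∫ ω, B t ω * B r ω ∂P) (fun r => min t r) (uIcc 0 1) := fun r hr =>
    hB.2.2.2 t ht r (by rwa [uIcc_of_le zero_le_one] at hr)
  have hc : Continuous fun r : ℝ => min t r := by fun_prop
  rw [intervalIntegral.integral_congr hcov, ← intervalIntegral.integral_add_adjacent_intervals
    (hc.intervalIntegrable 0 t) (hc.intervalIntegrable t 1)]
  have h1 : ∫ r in (0:ℝ)..t, min t r = ∫ r in (0:ℝ)..t, r :=
    intervalIntegral.integral_congr fun r hr => by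
      rw [uIcc_of_le ht.1] at hr
      exact min_eq_right hr.2
  have h2 : ∫ r in t..1, min t r = ∫ r in t..1, t :=
    intervalIntegral.integral_congr fun r hr => by
      rw [uIcc_of_le ht.2] at hr
      exact min_eq_left hr.1
  rw [h1, h2, integral_id, intervalIntegral.integral_const, smul_eq_mul]
  ring

lemma IsBrownianMotion.integral_average_mul_average [IsProbabilityMeasure P]
    (hB : IsBrownianMotion P B) :
    ∫ ω, (∫ r in (0:ℝ)..1, B r ω) * (∫ r in (0:ℝ)..1, B r ω) ∂P = 1 / 3 := by
  have hA2 : MemLp (fun ω => ∫ r in (0:ℝ)..1, B r ω) 2 P :=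
    (hB.isGaussianProcess_withAverage.hasGaussianLaw_eval none).memLp_two
  rw [hB.integral_mul_intervalIntegral hA2]
  have hcov : EqOn (fun s => ∫ ω, (∫ r in (0:ℝ)..1, B r ω) * B s ω ∂P)
      (fun s => s - s ^ 2 / 2) (uIcc 0 1) := fun s hs => by
    rw [uIcc_of_le zero_le_one] at hs
    simp only [mul_comm _ (B s _)]
    exact hB.integral_mul_average hs
  rw [intervalIntegral.integral_congr hcov, intervalIntegral.integral_sub (by simp)
    (Continuous.intervalIntegrable (by fun_prop) _ _), integral_id,
    intervalIntegral.integral_div, integral_pow]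
  norm_num

lemma IsBrownianMotion.map_average [IsProbabilityMeasure P] (hB : IsBrownianMotion P B) :
    P.map (fun ω => ∫ r in (0:ℝ)..1, B r ω) = gaussianReal 0 (1 / 3 : NNReal) := by
  have h := hB.isGaussianProcess_withAverage.hasGaussianLaw_eval none
  have hm := hB.integral_withAverage none
  have hv : Var[withAverage B none; P] = 1 / 3 := by
    rw [variance_eq_integral (hB.measurable_withAverage none).aemeasurable, hm,
      ← hB.integral_average_mul_average]
    simp [withAverage, pow_two]
  have hmap := h.map_eq_gaussianReal
  rw [hm, hv] at hmap
  rw [show (1 / 3 : NNReal) = (1 / 3 : ℝ).toNNReal by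
    rw [Real.toNNReal_div zero_le_one]; simp]
  exact hmap

/-- The Brownian motion minus its regression on its time average is independent of the
time average. -/
lemma IsBrownianMotion.indepFun_sub_average [IsProbabilityMeasure P]
    (hB : IsBrownianMotion P B) :
    IndepFun (fun ω (t : Icc (0:ℝ) 1) =>
        B t ω - 3 / 2 * t * (2 - t) * ∫ r in (0:ℝ)..1, B r ω)
      (fun ω => ∫ r in (0:ℝ)..1, B r ω) P := by
  classical
  let Y : Icc (0:ℝ) 1 → Ω → ℝ := fun t ω =>
    B t ω - 3 / 2 * t * (2 - t) * ∫ r in (0:ℝ)..1, B r ω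
  let A : Unit → Ω → ℝ := fun _ ω => ∫ r in (0:ℝ)..1, B r ω
  have hA : Measurable (A ()) := hB.measurable_intervalIntegral
  have hY : ∀ t, Measurable (Y t) := fun t => (hB.1 t).sub (hA.const_mul _)
  have hG : IsGaussianProcess (Sum.elim Y A) P := by
    refine hB.isGaussianProcess_withAverage.of_isGaussianProcess ?_
    rintro (t | _)
    · refine ⟨{some t, none},
        ContinuousLinearMap.proj (R := ℝ) (φ := fun _ => ℝ) ⟨some t, by simp⟩ -
          (3 / 2 * t * (2 - t) : ℝ) •
            ContinuousLinearMap.proj (R := ℝ) (φ := fun _ => ℝ) ⟨none, by simp⟩, fun ω => ?_⟩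
      simp [Y, withAverage]
    · refine ⟨{none}, ContinuousLinearMap.proj (R := ℝ) (φ := fun _ => ℝ) ⟨none, by simp⟩,
        fun ω => ?_⟩
      simp [A, withAverage]
  have hcov : ∀ s t, cov[Y s, A t; P] = 0 := by
    intro s _
    have hG' := hB.isGaussianProcess_withAverage
    have hA2 : MemLp (A ()) 2 P := (hG'.hasGaussianLaw_eval none).memLp_two
    have hB2 := hB.memLp_two s.2
    have hY2 : MemLp (Y s) 2 P := (hG.hasGaussianLaw_eval (Sum.inl s)).memLp_two
    have hAm : ∫ ω, A () ω ∂P = 0 := hB.integral_withAverage none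
    rw [covariance_eq_sub hY2 hA2, hAm, mul_zero, sub_zero]
    have hexp : ∀ ω, (Y s * A ()) ω = B s ω * A () ω -
        3 / 2 * s * (2 - s) * (A () ω * A () ω) := fun ω => by
      simp only [Y, A, Pi.mul_apply]
      ring
    simp only [hexp]
    have hi1 : Integrable (fun ω => B s ω * A () ω) P := hB2.integrable_mul hA2
    have hi2 : Integrable (fun ω => A () ω * A () ω) P := hA2.integrable_mul hA2
    rw [integral_sub hi1 (hi2.const_mul _),
      integral_const_mul, hB.integral_mul_average s.2, hB.integral_average_mul_average]
    ring
  have hind := hG.indepFun_of_covariance_eq_zero (fun s => (hY s).aemeasurable)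
    (fun _ => hA.aemeasurable) hcov
  exact hind.comp measurable_id (measurable_pi_apply ())

end Brownian

/-- The family of laws of `B^c_t = B_t + (3/2)t(2-t)(c - ∫₀¹ B)`, `c ∈ ℝ`, is a regular
conditional distribution of the Brownian motion `B` given its time average, which has
law `N(0, 1/3)`: for every bounded Borel `Φ` on paths and bounded Borel `f` on `ℝ`,
`E[Φ(B) f(∫₀¹ B)] = ∫ E[Φ(B^c)] f(c) N(0,1/3)(dc)`. -/
theorem bm_conditioned_on_average
    {Ω : Type*} [MeasurableSpace Ω] (P : Measure Ω) [IsProbabilityMeasure P]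
    (B : ℝ → Ω → ℝ) (hB : IsBrownianMotion P B)
    (Bc : ℝ → ℝ → Ω → ℝ)
    (hBc : ∀ c t ω, Bc c t ω
      = B t ω + (3/2) * t * (2 - t) * (c - ∫ r in (0:ℝ)..1, B r ω))
    (Φ : (Icc (0:ℝ) 1 → ℝ) → ℝ) (hΦ : Measurable Φ) (hΦb : ∃ C, ∀ x, |Φ x| ≤ C)
    (f : ℝ → ℝ) (hf : Measurable f) (hfb : ∃ C, ∀ x, |f x| ≤ C) :
    ∫ ω, Φ (fun t => B t.1 ω) * f (∫ r in (0:ℝ)..1, B r ω) ∂P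
      = ∫ c, (∫ ω, Φ (fun t => Bc c t.1 ω) ∂P) * f c
          ∂(gaussianReal 0 (1/3 : NNReal)) := by
  obtain ⟨C, hC⟩ := hΦb
  obtain ⟨D, hD⟩ := hfb
  let A : Ω → ℝ := fun ω => ∫ r in (0:ℝ)..1, B r ω
  let Y : Ω → Icc (0:ℝ) 1 → ℝ := fun ω t =>
    B t ω - 3 / 2 * t * (2 - t) * ∫ r in (0:ℝ)..1, B r ω
  have hA : Measurable A := hB.measurable_intervalIntegral
  have hY : Measurable Y := measurable_pi_lambda _ fun t => (hB.1 t).sub (hA.const_mul _)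
  let shift : (Icc (0:ℝ) 1 → ℝ) × ℝ → Icc (0:ℝ) 1 → ℝ := fun q t =>
    q.1 t + 3 / 2 * t * (2 - t) * q.2
  have hshift : Measurable shift := measurable_pi_lambda _ fun t =>
    ((measurable_pi_apply t).comp measurable_fst).add (measurable_snd.const_mul _)
  have hg : Measurable fun q : (Icc (0:ℝ) 1 → ℝ) × ℝ => Φ (shift q) * f q.2 :=
    (hΦ.comp hshift).mul (hf.comp measurable_snd)
  have hlaw : P.map (fun ω => (Y ω, A ω)) =
      (P.map Y).prod (gaussianReal 0 (1 / 3 : NNReal)) := by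
    rw [← hB.map_average]
    exact hB.indepFun_sub_average.map_prod_eq_prod_map_map hY.aemeasurable hA.aemeasurable
  have : IsProbabilityMeasure (P.map Y) := Measure.isProbabilityMeasure_map hY.aemeasurable
  have hint : Integrable (fun q : (Icc (0:ℝ) 1 → ℝ) × ℝ => Φ (shift q) * f q.2)
      ((P.map Y).prod (gaussianReal 0 (1 / 3 : NNReal))) := by
    refine Integrable.of_bound hg.aestronglyMeasurable (C * D)
      (Filter.Eventually.of_forall fun q => ?_)
    rw [Real.norm_eq_abs, abs_mul]
    exact mul_le_mul (hC _) (hD _) (abs_nonneg _) ((abs_nonneg _).trans (hC (shift q)))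
  calc ∫ ω, Φ (fun t => B t.1 ω) * f (A ω) ∂P
      = ∫ ω, Φ (shift (Y ω, A ω)) * f (A ω) ∂P := by
        simp only [shift, Y, A, sub_add_cancel]
    _ = ∫ q, Φ (shift q) * f q.2 ∂(P.map fun ω => (Y ω, A ω)) :=
        (integral_map (hY.prodMk hA).aemeasurable hg.aestronglyMeasurable).symm
    _ = ∫ c, ∫ y, Φ (shift (y, c)) * f c ∂(P.map Y) ∂(gaussianReal 0 (1 / 3 : NNReal)) := by
        rw [hlaw, integral_prod_symm _ hint]
    _ = _ := by
        refine integral_congr_ae (Filter.Eventually.of_forall fun c => ?_)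
        simp only
        have hΦc : Measurable fun y => Φ (shift (y, c)) :=
          hΦ.comp (hshift.comp measurable_prodMk_right)
        rw [integral_mul_const, integral_map hY.aemeasurable hΦc.aestronglyMeasurable]
        congr 2 with ω
        congr 1 with t
        simp only [shift, Y, hBc]
        ring
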